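/- Let r > 0, θ ∈ ℝ, σ > 0, and let h be the indicator function h(x) = 1 if x ≤ 0 and h(x) = 0 if x > 0. Let f be the solution of the VG(r,θ,σ,0) Stein equation with test function h. Then there exist a function g : ℝ → ℝ such that f has derivative g(x) at every x ≠ 0, and real numbers L₊ and L₋ such that g(x) → L₊ as x → 0 from the right, g(x) → L₋ as x → 0 from the left, and L₊ − L₋ = −1/(r·σ²). In particular, g is discontinuous at 0 and f is not differentiable at 0 with a continuous derivative. -/

import Mathlib

open MeasureTheory Real Filter

/-- Modified Bessel function of the second kind. -/
noncomputable def besselK (ν x : ℝ) : ℝ :=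
  ∫ t in Set.Ioi (0:ℝ), Real.exp (-x * Real.cosh t) * Real.cosh (ν * t)

/-- Modified Bessel function of the first kind. -/
noncomputable def besselI (ν x : ℝ) : ℝ :=
  ∑' k : ℕ, (x / 2) ^ (ν + 2 * (k : ℝ)) / (Real.Gamma (ν + (k : ℝ) + 1) * (Nat.factorial k))

/-- The VG(r,θ,σ,0) density. -/
noncomputable def vgDensity (r θ σ x : ℝ) : ℝ :=
  (σ * Real.sqrt Real.pi * Real.Gamma (r / 2))⁻¹ * Real.exp (θ * x / σ ^ 2) *
    (|x| / (2 * Real.sqrt (θ ^ 2 + σ ^ 2))) ^ ((r - 1) / 2) *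
    besselK ((r - 1) / 2) (Real.sqrt (θ ^ 2 + σ ^ 2) * |x| / σ ^ 2)

/-- The centred test function h̃(x) = h(x) − E h(Z). -/
noncomputable def htilde (r θ σ : ℝ) (h : ℝ → ℝ) (x : ℝ) : ℝ :=
  h x - ∫ t, h t * vgDensity r θ σ t

/-- The solution of the VG(r,θ,σ,0) Stein equation with test function h. -/
noncomputable def steinSolution (r θ σ : ℝ) (h : ℝ → ℝ) (x : ℝ) : ℝ :=
  -(Real.exp (-(θ / σ ^ 2) * x) *
      besselK ((r - 1) / 2) (Real.sqrt (θ ^ 2 + σ ^ 2) / σ ^ 2 * |x|) /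
      (σ ^ 2 * |x| ^ ((r - 1) / 2))) *
    (∫ t in (0:ℝ)..x, Real.exp ((θ / σ ^ 2) * t) * |t| ^ ((r - 1) / 2) *
      besselI ((r - 1) / 2) (Real.sqrt (θ ^ 2 + σ ^ 2) / σ ^ 2 * |t|) * htilde r θ σ h t) -
  (Real.exp (-(θ / σ ^ 2) * x) *
      besselI ((r - 1) / 2) (Real.sqrt (θ ^ 2 + σ ^ 2) / σ ^ 2 * |x|) /
      (σ ^ 2 * |x| ^ ((r - 1) / 2))) *
    (∫ t in Set.Ioi x, Real.exp ((θ / σ ^ 2) * t) * |t| ^ ((r - 1) / 2) *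
      besselK ((r - 1) / 2) (Real.sqrt (θ ^ 2 + σ ^ 2) / σ ^ 2 * |t|) * htilde r θ σ h t)

/-- The constant A(r,θ,σ). -/
noncomputable def Aconst (r θ σ : ℝ) : ℝ :=
  if 2 ≤ r then 2 * Real.sqrt Real.pi / Real.sqrt (2 * r - 1) * (1 + θ ^ 2 / σ ^ 2) ^ (r / 2)
  else 12 * Real.Gamma (r / 2) * (1 + θ ^ 2 / σ ^ 2)

/-- The constant B(r,θ,σ). -/
noncomputable def Bconst (r θ σ : ℝ) : ℝ :=
  if 2 ≤ r then Real.sqrt (Real.pi * (r - 1) / 2) * (1 + θ ^ 2 / σ ^ 2) ^ (r / 2 - 1)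
  else 2

/-- The constant C(r,θ,σ). -/
noncomputable def Cconst (r θ σ : ℝ) : ℝ :=
  6 + 2 * Real.sqrt 2 / Real.sqrt r +
    2 * Real.sqrt (2 * Real.pi * (r + 1)) * (|θ| / σ) * (1 + θ ^ 2 / σ ^ 2) ^ ((r - 1) / 2) +
    2 * (Real.sqrt (2 * r) + r) * Aconst r θ σ

open Topology Set

noncomputable def Mh (a y : ℝ) : ℝ := ∫ s in Set.Ioi (0:ℝ), s ^ (a - 1) * Real.exp (-s - y / s)

lemma exp_neg_div_le {s y p : ℝ} (hs : 0 < s) (hy : 0 < y) (hp : 0 < p) :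
    Real.exp (-(y / s)) ≤ p ^ p * (s ^ p * y ^ (-p)) := by
  have hu : 0 < y / s := div_pos hy hs
  have h1 : y / s / p ≤ Real.exp (y / s / p) := by
    linarith [Real.add_one_le_exp (y / s / p)]
  have h2 : (y / s / p) ^ p ≤ Real.exp (y / s) := by
    calc (y / s / p) ^ p ≤ (Real.exp (y / s / p)) ^ p :=
          Real.rpow_le_rpow (by positivity) h1 hp.le
      _ = Real.exp (y / s) := by
          rw [← Real.exp_mul]; congr 1; field_simp
  rw [Real.exp_neg]
  have h3 : (0:ℝ) < (y / s / p) ^ p := by positivity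
  calc (Real.exp (y / s))⁻¹ ≤ ((y / s / p) ^ p)⁻¹ := inv_anti₀ h3 h2
    _ = p ^ p * (s ^ p * y ^ (-p)) := by
      rw [Real.div_rpow hu.le hp.le, Real.div_rpow hy.le hs.le, Real.rpow_neg hy.le]
      have := Real.rpow_pos_of_pos hy p
      have := Real.rpow_pos_of_pos hs p
      have := Real.rpow_pos_of_pos hp p
      field_simp

lemma Mh_contOn (a y : ℝ) :
    ContinuousOn (fun s : ℝ => s ^ (a - 1) * Real.exp (-s - y / s)) (Set.Ioi 0) := by
  intro s hs
  have hs' : (s:ℝ) ≠ 0 := ne_of_gt hs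
  apply ContinuousAt.continuousWithinAt
  refine (Real.continuousAt_rpow_const _ _ (Or.inl hs')).mul ?_
  have : ContinuousAt (fun s : ℝ => -s - y / s) s := by fun_prop (disch := assumption)
  exact this.rexp

lemma Mh_meas (a y : ℝ) :
    AEStronglyMeasurable (fun s : ℝ => s ^ (a - 1) * Real.exp (-s - y / s))
      (volume.restrict (Set.Ioi 0)) :=
  (Mh_contOn a y).aestronglyMeasurable measurableSet_Ioi

lemma Mh_pt_bound {a y p l s : ℝ} (hs : 0 < s) (hy : 0 < y) (hp : 0 < p) (hl : 0 < l) (hl1 : l ≤ 1) :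
    s ^ (a - 1) * Real.exp (-s - y / s) ≤
      (p ^ p * (l * y) ^ (-p) * Real.exp (-(1 - l) * (2 * Real.sqrt y))) *
        (s ^ (a + p - 1) * Real.exp (-l * s ^ (1:ℝ))) := by
  have h1 : 2 * Real.sqrt y ≤ s + y / s := by
    have hq := Real.sq_sqrt hy.le
    have : s + y / s - 2 * Real.sqrt y = (s - Real.sqrt y) ^ 2 / s := by
      field_simp
      nlinarith
    have h2 : 0 ≤ (s - Real.sqrt y) ^ 2 / s := by positivity
    linarith
  have h2 : Real.exp (-s - y / s) ≤ Real.exp (-(1 - l) * (2 * Real.sqrt y)) *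
      (Real.exp (-l * s) * Real.exp (-((l * y) / s))) := by
    rw [← Real.exp_add, ← Real.exp_add]
    apply Real.exp_le_exp.2
    have : (1 - l) * (2 * Real.sqrt y) ≤ (1 - l) * (s + y / s) :=
      mul_le_mul_of_nonneg_left h1 (by linarith)
    have e : l * y / s = l * (y / s) := by ring
    rw [e]; linarith
  have h3 := exp_neg_div_le hs (mul_pos hl hy) hp
  have e : s ^ (a + p - 1) = s ^ (a - 1) * s ^ p := by
    rw [← Real.rpow_add hs]; congr 1; ring
  rw [Real.rpow_one, e]
  calc s ^ (a - 1) * Real.exp (-s - y / s)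
      ≤ s ^ (a - 1) * (Real.exp (-(1 - l) * (2 * Real.sqrt y)) *
      (Real.exp (-l * s) * (p ^ p * (s ^ p * (l * y) ^ (-p))))) := by
        gcongr
        exact h2.trans (by gcongr)
    _ = _ := by ring

lemma Mh_int (a : ℝ) {y : ℝ} (hy : 0 < y) :
    IntegrableOn (fun s : ℝ => s ^ (a - 1) * Real.exp (-s - y / s)) (Set.Ioi 0) := by
  have hp : 0 < |a| + 1 := by positivity
  have hi := integrableOn_rpow_mul_exp_neg_mul_rpow (p := 1) (s := a + (|a| + 1) - 1) (b := 1)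
    (by linarith [neg_abs_le a]) one_pos one_pos
  refine Integrable.mono' (hi.const_mul ((|a| + 1) ^ (|a| + 1) * (1 * y) ^ (-(|a| + 1)) *
    Real.exp (-(1 - 1) * (2 * Real.sqrt y)))) (Mh_meas a y) ?_
  filter_upwards [ae_restrict_mem measurableSet_Ioi] with s hs
  have hs : 0 < s := hs
  rw [Real.norm_of_nonneg (by positivity)]
  exact Mh_pt_bound hs hy hp one_pos le_rfl

lemma Mh_nonneg (a y : ℝ) : 0 ≤ Mh a y := by
  apply setIntegral_nonneg measurableSet_Ioi
  intro s hs
  have hs : 0 < s := hs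
  positivity

lemma Mh_bound {a p l : ℝ} (hp : 0 < p) (hap : 0 < a + p) (hl : 0 < l) (hl1 : l ≤ 1) :
    ∃ C : ℝ, 0 ≤ C ∧ ∀ y : ℝ, 0 < y →
      Mh a y ≤ C * (y ^ (-p) * Real.exp (-(1 - l) * (2 * Real.sqrt y))) := by
  have hi := integrableOn_rpow_mul_exp_neg_mul_rpow (p := 1) (s := a + p - 1) (b := l)
    (by linarith) one_pos hl
  refine ⟨p ^ p * l ^ (-p) * ∫ s in Set.Ioi (0:ℝ), (s ^ (a + p - 1) * Real.exp (-l * s ^ (1:ℝ))),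
    ?_, ?_⟩
  · apply mul_nonneg (by positivity)
    apply setIntegral_nonneg measurableSet_Ioi
    intro s hs
    have hs : 0 < s := hs
    positivity
  · intro y hy
    have := setIntegral_mono_on (Mh_int a hy) (hi.const_mul
      (p ^ p * (l * y) ^ (-p) * Real.exp (-(1 - l) * (2 * Real.sqrt y)))) measurableSet_Ioi
      (fun s hs => Mh_pt_bound (a := a) (p := p) (l := l) hs hy hp hl hl1)
    rw [MeasureTheory.integral_const_mul] at this
    refine this.trans (le_of_eq ?_)
    rw [Real.mul_rpow hl.le hy.le]
    ring

lemma Mh_hasDerivAt (a : ℝ) {y : ℝ} (hy : 0 < y) : HasDerivAt (Mh a) (-Mh (a - 1) y) y := by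
  have key := hasDerivAt_integral_of_dominated_loc_of_deriv_le (μ := volume.restrict (Set.Ioi 0))
    (F := fun y s : ℝ => s ^ (a - 1) * Real.exp (-s - y / s))
    (F' := fun y s : ℝ => -(s ^ (a - 1 - 1) * Real.exp (-s - y / s)))
    (bound := fun s : ℝ => s ^ (a - 1 - 1) * Real.exp (-s - (y / 2) / s))
    (x₀ := y) (s := Set.Ioi (y / 2)) (Ioi_mem_nhds (by linarith))
    (Eventually.of_forall fun y => Mh_meas a y) (Mh_int a hy)
    (Mh_meas (a - 1) y).neg ?_ (Mh_int (a - 1) (by linarith)) ?_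
  · have := key.2
    rw [MeasureTheory.integral_neg] at this
    exact this
  · filter_upwards [ae_restrict_mem measurableSet_Ioi] with s hs z hz
    have hs : 0 < s := hs
    have hz : y / 2 < z := hz
    rw [norm_neg, Real.norm_of_nonneg (by positivity)]
    gcongr
  · filter_upwards [ae_restrict_mem measurableSet_Ioi] with s hs z hz
    have hs : 0 < s := hs
    have h1 : HasDerivAt (fun z : ℝ => -s - z / s) (-(1 / s)) z := by
      simpa using ((hasDerivAt_id z).div_const s).const_sub (-s)
    refine ((h1.exp).const_mul (s ^ (a - 1))).congr_deriv ?_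
    rw [Real.rpow_sub_one hs.ne' (a - 1)]
    field_simp

lemma Mh_tendsto {a : ℝ} (ha : 0 < a) : Tendsto (Mh a) (𝓝[>] 0) (𝓝 (Real.Gamma a)) := by
  rw [Real.Gamma_eq_integral ha]
  have e : ∫ x in Set.Ioi (0:ℝ), Real.exp (-x) * x ^ (a - 1) =
     ∫ x in Set.Ioi (0:ℝ), x ^ (a - 1) * Real.exp (-x - 0 / x) := by
    simp [mul_comm]
  rw [e]
  refine tendsto_integral_filter_of_dominated_convergence
    (fun s => Real.exp (-s) * s ^ (a - 1)) ?_ ?_ (Real.GammaIntegral_convergent ha) ?_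
  · exact Eventually.of_forall fun y => Mh_meas a y
  · filter_upwards [self_mem_nhdsWithin] with y hy
    filter_upwards [ae_restrict_mem measurableSet_Ioi] with s hs
    have hs : 0 < s := hs
    have hy : 0 < y := hy
    rw [Real.norm_of_nonneg (by positivity), mul_comm]
    gcongr
    have : 0 < y / s := by positivity
    linarith
  · filter_upwards [ae_restrict_mem measurableSet_Ioi] with s hs
    have hs : 0 < s := hs
    have : Continuous (fun y : ℝ => s ^ (a - 1) * Real.exp (-s - y / s)) := by fun_prop
    exact (this.tendsto 0).mono_left nhdsWithin_le_nhds

lemma Mh_exp (a : ℝ) {y : ℝ} (hy : 0 < y) :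
    Integrable (fun t : ℝ => Real.exp (a * t) * Real.exp (-Real.exp t - y / Real.exp t)) ∧
    Mh a y = ∫ t : ℝ, Real.exp (a * t) * Real.exp (-Real.exp t - y / Real.exp t) := by
  have him : Real.exp '' univ = Set.Ioi 0 := by rw [Set.image_univ, Real.range_exp]
  have hd : ∀ x ∈ (univ : Set ℝ), HasDerivWithinAt Real.exp (Real.exp x) univ x :=
    fun x _ => (Real.hasDerivAt_exp x).hasDerivWithinAt
  have e : ∀ t : ℝ, |Real.exp t| • ((Real.exp t) ^ (a - 1) *
      Real.exp (-Real.exp t - y / Real.exp t)) =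
      Real.exp (a * t) * Real.exp (-Real.exp t - y / Real.exp t) := by
    intro t
    rw [abs_of_pos (Real.exp_pos t), smul_eq_mul, ← Real.exp_mul, ← mul_assoc, ← Real.exp_add]
    congr 2; ring
  have hi := Mh_int a hy
  have hinj : Set.InjOn Real.exp univ := Real.exp_injective.injOn
  constructor
  · rw [← him, integrableOn_image_iff_integrableOn_abs_deriv_smul MeasurableSet.univ hd hinj] at hi
    simp only [e] at hi
    rwa [integrableOn_univ] at hi
  · unfold Mh
    rw [← him, integral_image_eq_integral_abs_deriv_smul MeasurableSet.univ hd hinj]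
    simp only [e]
    rw [setIntegral_univ]

lemma besselK_eq (a : ℝ) {z : ℝ} (hz : 0 < z) :
    besselK a z = 1 / 2 * (z / 2) ^ (-a) * Mh a ((z / 2) ^ 2) := by
  have hw : 0 < z / 2 := by linarith
  obtain ⟨hi, he⟩ := Mh_exp a (y := (z / 2) ^ 2) (by positivity)
  set L := Real.log (z / 2) with hL
  have heL : Real.exp L = z / 2 := Real.exp_log hw
  have e1 : ∀ t : ℝ, Real.exp (a * (t + L)) *
      Real.exp (-Real.exp (t + L) - (z / 2) ^ 2 / Real.exp (t + L)) =
      (z / 2) ^ a * (Real.exp (-z * Real.cosh t) * Real.exp (a * t)) := by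
    intro t
    have h1 : Real.exp (a * (t + L)) = (z / 2) ^ a * Real.exp (a * t) := by
      rw [← heL, ← Real.exp_mul, ← Real.exp_add]; congr 1; ring
    have h2 : -Real.exp (t + L) - (z / 2) ^ 2 / Real.exp (t + L) = -z * Real.cosh t := by
      rw [Real.exp_add, heL, Real.cosh_eq, Real.exp_neg]
      field_simp
      ring
    rw [h1, h2]; ring
  have hi2 := hi.comp_add_right L
  simp only [e1] at hi2
  rw [← integral_add_right_eq_self _ L] at he
  simp only [e1] at he
  rw [MeasureTheory.integral_const_mul] at he
  have hpos : 0 < (z / 2) ^ a := Real.rpow_pos_of_pos hw a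
  have hi3 : Integrable (fun t : ℝ => Real.exp (-z * Real.cosh t) * Real.exp (a * t)) := by
    have := hi2.const_mul ((z / 2) ^ a)⁻¹
    refine this.congr (Eventually.of_forall fun t => ?_)
    simp only
    field_simp
  have hs : ∫ t : ℝ, Real.exp (-z * Real.cosh t) * Real.exp (a * t) = 2 * besselK a z := by
    rw [← intervalIntegral.integral_Iic_add_Ioi (b := 0) hi3.integrableOn hi3.integrableOn]
    have h1 := integral_comp_neg_Ioi 0 (fun t : ℝ => Real.exp (-z * Real.cosh t) * Real.exp (a * t))
    rw [neg_zero] at h1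
    rw [← h1, ← MeasureTheory.integral_add]
    · unfold besselK
      rw [← MeasureTheory.integral_const_mul]
      congr 1
      ext t
      rw [Real.cosh_neg, Real.cosh_eq (a * t)]
      rw [show a * -t = -(a * t) by ring]
      ring
    · exact hi3.comp_neg.integrableOn
    · exact hi3.integrableOn
  rw [he, hs, Real.rpow_neg hw.le]
  field_simp

lemma besselK_neg (a z : ℝ) : besselK (-a) z = besselK a z := by
  unfold besselK
  simp

lemma Mh_neg (a : ℝ) {w : ℝ} (hw : 0 < w) : Mh (-a) (w ^ 2) = w ^ (-(2 * a)) * Mh a (w ^ 2) := by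
  have h1 := besselK_eq a (z := 2 * w) (by positivity)
  have h2 := besselK_eq (-a) (z := 2 * w) (by positivity)
  rw [besselK_neg, h1] at h2
  have e : 2 * w / 2 = w := by ring
  rw [e, neg_neg] at h2
  have h3 : w ^ (-(2 * a)) = (w ^ a)⁻¹ * w ^ (-a) := by
    rw [← Real.rpow_neg hw.le, ← Real.rpow_add hw]; congr 1; ring
  have := Real.rpow_pos_of_pos hw a
  rw [h3]
  field_simp
  linarith

noncomputable def cI (ν : ℝ) (k : ℕ) : ℝ := 1 / (Real.Gamma (ν + (k : ℝ) + 1) * (Nat.factorial k))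

noncomputable def SI (ν y : ℝ) : ℝ := ∑' k : ℕ, cI ν k * y ^ k

lemma cI_pos {ν : ℝ} (hν : -1 < ν) (k : ℕ) : 0 < cI ν k := by
  have h0 : (0:ℝ) ≤ (k:ℝ) := Nat.cast_nonneg k
  have : 0 < Real.Gamma (ν + (k : ℝ) + 1) := Real.Gamma_pos_of_pos (by linarith)
  unfold cI
  positivity

lemma SI_analytic {ν : ℝ} (hν : -1 < ν) (y : ℝ) : AnalyticAt ℝ (SI ν) y := by
  have hrad : (FormalMultilinearSeries.ofScalars ℝ (cI ν)).radius = ⊤ := by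
    apply FormalMultilinearSeries.ofScalars_radius_eq_top_of_tendsto
    · exact Eventually.of_forall fun k => (cI_pos hν k).ne'
    · have h1 : Tendsto (fun n : ℕ => 1 / ((n:ℝ) + 1) * (1 / (ν + 1 + n))) atTop (𝓝 (0 * 0)) := by
        apply tendsto_one_div_add_atTop_nhds_zero_nat.mul
        have : Tendsto (fun n : ℕ => ν + 1 + (n:ℝ)) atTop atTop :=
          tendsto_atTop_add_const_left _ _ tendsto_natCast_atTop_atTop
        simp only [one_div]
        exact this.inv_tendsto_atTop
      rw [mul_zero] at h1
      refine h1.congr fun n => ?_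
      rw [Real.norm_of_nonneg (cI_pos hν _).le, Real.norm_of_nonneg (cI_pos hν _).le]
      have h0 : (0:ℝ) ≤ (n:ℝ) := Nat.cast_nonneg n
      have hp : 0 < ν + n + 1 := by linarith
      have hp' : 0 < ν + 1 + n := by linarith
      have hg : 0 < Real.Gamma (ν + (n : ℝ) + 1) := Real.Gamma_pos_of_pos hp
      have hf : (0:ℝ) < (Nat.factorial n : ℝ) := by positivity
      unfold cI
      rw [Nat.succ_eq_add_one, Nat.factorial_succ]
      push_cast
      rw [show ν + ((n:ℝ) + 1) + 1 = (ν + n + 1) + 1 by ring, Real.Gamma_add_one hp.ne']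
      rw [show ν + 1 + (n:ℝ) = ν + n + 1 by ring]
      field_simp
  have hb := FormalMultilinearSeries.hasFPowerSeriesOnBall
    (FormalMultilinearSeries.ofScalars ℝ (cI ν)) (by rw [hrad]; exact ENNReal.zero_lt_top)
  have he : (FormalMultilinearSeries.ofScalars ℝ (cI ν)).sum = SI ν := by
    ext z
    have := FormalMultilinearSeries.ofScalars_sum_eq (E := ℝ) (cI ν) z
    simpa [FormalMultilinearSeries.ofScalarsSum, SI] using this
  rw [he] at hb
  exact hb.analyticAt_of_mem (by simp [hrad])

lemma SI_zero (ν : ℝ) : SI ν 0 = 1 / Real.Gamma (ν + 1) := by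
  unfold SI
  rw [tsum_eq_single 0]
  · simp [cI]
  · intro k hk
    simp [hk]

lemma besselI_eq (ν : ℝ) {z : ℝ} (hz : 0 < z) :
    besselI ν z = (z / 2) ^ ν * SI ν ((z / 2) ^ 2) := by
  unfold besselI SI
  rw [← tsum_mul_left]
  congr 1
  ext k
  have hw : 0 < z / 2 := by linarith
  rw [Real.rpow_add hw, ← pow_mul]
  have : (z / 2) ^ (2 * (k:ℝ)) = (z / 2) ^ (2 * k) := by
    rw [← Real.rpow_natCast]; push_cast; rfl
  rw [this]
  unfold cI
  ring

lemma integrable_abs_weight {ρ d : ℝ} (hρ : -1 < ρ) (hd : 0 < d) :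
    Integrable (fun t : ℝ => |t| ^ ρ * Real.exp (-d * |t|)) := by
  have h := integrableOn_rpow_mul_exp_neg_mul_rpow (p := 1) (s := ρ) (b := d) hρ one_pos hd
  simp only [Real.rpow_one] at h
  have h1 : IntegrableOn (fun t : ℝ => |t| ^ ρ * Real.exp (-d * |t|)) (Set.Ioi 0) :=
    h.congr_fun (fun t ht => by
      have ht : 0 < t := ht
      simp only [abs_of_pos ht]) measurableSet_Ioi
  have h2 : IntegrableOn (fun t : ℝ => |t| ^ ρ * Real.exp (-d * |t|)) (Set.Iio 0) := by
    have h1' : IntegrableOn (fun t : ℝ => |t| ^ ρ * Real.exp (-d * |t|)) (Set.Ioi (-0)) := by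
      rwa [neg_zero]
    have := h1'.comp_neg_Iio
    simpa using this
  rw [← integrableOn_univ, ← @Iio_union_Ici _ _ (0 : ℝ), integrableOn_union,
    integrableOn_Ici_iff_integrableOn_Ioi]
  exact ⟨h2, h1⟩

lemma intervalIntegrable_abs_mul {ρ : ℝ} (hρ : -1 < ρ) {φ : ℝ → ℝ} (hφ : Continuous φ) (a b : ℝ) :
    IntervalIntegrable (fun t : ℝ => |t| ^ ρ * φ t) volume a b := by
  have h := (integrable_abs_weight hρ one_pos).intervalIntegrable (a := a) (b := b)
  have h2 := h.mul_continuousOn (g := fun t => Real.exp (|t|) * φ t)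
    (by fun_prop)
  refine h2.congr (fun t _ => ?_)
  rw [show |t| ^ ρ * Real.exp (-1 * |t|) * (Real.exp |t| * φ t) =
    |t| ^ ρ * φ t * (Real.exp (-1 * |t|) * Real.exp |t|) by ring, ← Real.exp_add]
  simp

lemma ftc_off_zero {w : ℝ → ℝ} (hc : ContinuousOn w {0}ᶜ)
    (hi : ∀ a b, IntervalIntegrable w volume a b) {x : ℝ} (hx : x ≠ 0) :
    HasDerivAt (fun u => ∫ t in (0:ℝ)..u, w t) (w x) x := by
  have ho : IsOpen ({0}ᶜ : Set ℝ) := isOpen_compl_singleton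
  apply intervalIntegral.integral_hasDerivAt_right (hi 0 x)
  · exact hc.stronglyMeasurableAtFilter ho x hx
  · exact hc.continuousAt (ho.mem_nhds hx)

lemma contOn_abs_rpow (ρ : ℝ) : ContinuousOn (fun t : ℝ => |t| ^ ρ) {0}ᶜ := by
  intro t ht
  apply ContinuousAt.continuousWithinAt
  exact (continuous_abs.continuousAt).rpow_const (Or.inl (abs_ne_zero.2 ht))

lemma hasDerivAt_x_abs_rpow (ρ : ℝ) {x : ℝ} (hx : x ≠ 0) :
    HasDerivAt (fun x : ℝ => x * |x| ^ ρ) ((ρ + 1) * |x| ^ ρ) x := by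
  have ha : |x| ≠ 0 := abs_ne_zero.2 hx
  have h1 := (hasDerivAt_abs hx).rpow_const (p := ρ) (Or.inl ha)
  refine ((hasDerivAt_id x).mul h1).congr_deriv ?_
  rw [Real.rpow_sub_one ha]
  have : (SignType.sign x : ℝ) * x = |x| := by
    rcases lt_or_gt_of_ne hx with h | h
    · simp [sign_neg h, abs_of_neg h]
    · simp [sign_pos h, abs_of_pos h]
  simp only [id]
  field_simp
  linear_combination ρ * this

lemma tendsto_abs_rpow_zero {ρ : ℝ} (hρ : 0 < ρ) :
    Tendsto (fun x : ℝ => |x| ^ ρ) (𝓝[≠] 0) (𝓝 0) := by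
  have : Continuous (fun x : ℝ => |x| ^ ρ) := continuous_abs.rpow_const (fun _ => Or.inr hρ.le)
  have h := (this.tendsto 0).mono_left (nhdsWithin_le_nhds (s := {0}ᶜ))
  simpa [Real.zero_rpow hρ.ne'] using h

lemma tendsto_x_abs_rpow {ρ : ℝ} (hρ : -1 < ρ) :
    Tendsto (fun x : ℝ => x * |x| ^ ρ) (𝓝[≠] 0) (𝓝 0) := by
  apply squeeze_zero_norm' _ (tendsto_abs_rpow_zero (ρ := ρ + 1) (by linarith))
  filter_upwards [self_mem_nhdsWithin] with x hx
  have ha : |x| ≠ 0 := abs_ne_zero.2 hx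
  rw [Real.rpow_add_one ha, norm_mul, Real.norm_eq_abs, Real.norm_of_nonneg (by positivity), mul_comm]

lemma primitive_tendsto_zero {w : ℝ → ℝ} (hi : ∀ a b, IntervalIntegrable w volume a b) :
    Tendsto (fun u => ∫ t in (0:ℝ)..u, w t) (𝓝[≠] 0) (𝓝 0) := by
  have := intervalIntegral.continuous_primitive hi 0
  have h := (this.tendsto 0).mono_left (nhdsWithin_le_nhds (s := {0}ᶜ))
  simpa using h

lemma weight_asymp {ρ : ℝ} (hρ : -1 < ρ) {φ : ℝ → ℝ} (hφ : Continuous φ) :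
    Tendsto (fun x : ℝ => (∫ t in (0:ℝ)..x, |t| ^ ρ * φ t) / (x * |x| ^ ρ)) (𝓝[≠] 0)
      (𝓝 (φ 0 / (ρ + 1))) := by
  have hρ1 : ρ + 1 ≠ 0 := by linarith
  apply HasDerivAt.lhopital_zero_nhdsNE (f' := fun x => |x| ^ ρ * φ x)
    (g' := fun x => (ρ + 1) * |x| ^ ρ)
  · filter_upwards [self_mem_nhdsWithin] with x hx
    exact ftc_off_zero ((contOn_abs_rpow ρ).mul hφ.continuousOn) (intervalIntegrable_abs_mul hρ hφ) hx
  · filter_upwards [self_mem_nhdsWithin] with x hx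
    exact hasDerivAt_x_abs_rpow ρ hx
  · filter_upwards [self_mem_nhdsWithin] with x hx
    have ha : 0 < |x| := abs_pos.2 hx
    have := Real.rpow_pos_of_pos ha ρ
    exact mul_ne_zero hρ1 this.ne'
  · exact primitive_tendsto_zero (intervalIntegrable_abs_mul hρ hφ)
  · exact tendsto_x_abs_rpow hρ
  · have h := (hφ.tendsto 0).mono_left (nhdsWithin_le_nhds (s := {0}ᶜ))
    refine (h.div_const (ρ + 1)).congr' ?_
    filter_upwards [self_mem_nhdsWithin] with x hx
    have ha : 0 < |x| := abs_pos.2 hx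
    have := Real.rpow_pos_of_pos ha ρ
    field_simp

lemma sq_abs_arg (q x : ℝ) : (q * x) ^ 2 = (q * |x|) ^ 2 := by
  rw [mul_pow, mul_pow, sq_abs]

lemma Mh_arg_hasDerivAt (a : ℝ) {q x : ℝ} (hq : 0 < q) (hx : x ≠ 0) :
    HasDerivAt (fun x => Mh a ((q * x) ^ 2)) (-Mh (a - 1) ((q * x) ^ 2) * (2 * q ^ 2 * x)) x := by
  have hy : 0 < (q * x) ^ 2 := by positivity
  have h1 : HasDerivAt (fun x : ℝ => (q * x) ^ 2) (2 * q ^ 2 * x) x := by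
    refine (((hasDerivAt_id x).const_mul q).pow 2).congr_deriv ?_
    simp only [id]; push_cast; ring
  exact (Mh_hasDerivAt a hy).comp x h1

lemma Mh_arg_contOn (a : ℝ) {q : ℝ} (hq : 0 < q) :
    ContinuousOn (fun x => Mh a ((q * x) ^ 2)) {0}ᶜ :=
  fun _ hx => (Mh_arg_hasDerivAt a hq hx).continuousAt.continuousWithinAt

lemma tendsto_arg {q : ℝ} (hq : 0 < q) : Tendsto (fun x : ℝ => (q * x) ^ 2) (𝓝[≠] 0) (𝓝[>] 0) := by
  apply tendsto_nhdsWithin_of_tendsto_nhds_of_eventually_within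
  · have : Continuous (fun x : ℝ => (q * x) ^ 2) := by fun_prop
    have h := (this.tendsto 0).mono_left (nhdsWithin_le_nhds (s := {0}ᶜ))
    simpa using h
  · filter_upwards [self_mem_nhdsWithin] with x hx
    have : x ≠ 0 := hx
    exact (by positivity : 0 < (q * x) ^ 2)

lemma wb_integrable {q β ν : ℝ} (hq : 0 < q) (hβ : |β| < 2 * q) (hν : -(1 / 2) < ν) (K : ℝ) :
    Integrable (fun t : ℝ => Real.exp (β * t) * (K * Mh ν ((q * t) ^ 2))) := by
  obtain ⟨p, hp, hνp, hp2⟩ : ∃ p : ℝ, 0 < p ∧ 0 < ν + p ∧ p < 1 / 2 := by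
    refine ⟨(max (-ν) 0 + 1 / 2) / 2, ?_, ?_, ?_⟩
    · have := le_max_right (-ν) 0; linarith
    · have h1 := le_max_left (-ν) 0
      have : max (-ν) 0 < 1 / 2 := max_lt (by linarith) (by norm_num)
      linarith
    · have : max (-ν) 0 < 1 / 2 := max_lt (by linarith) (by norm_num)
      linarith
  have hl : 0 < (1 - |β| / (2 * q)) / 2 := by
    have : |β| / (2 * q) < 1 := (div_lt_one (by positivity)).2 hβ
    linarith
  have hl1 : (1 - |β| / (2 * q)) / 2 ≤ 1 := by
    have : 0 ≤ |β| / (2 * q) := by positivity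
    linarith
  obtain ⟨C, hC, hM⟩ := Mh_bound hp hνp hl hl1
  have hd : 0 < q - |β| / 2 := by linarith
  have hW := (integrable_abs_weight (ρ := -(2 * p)) (by linarith) hd).const_mul
    (|K| * C * q ^ (-(2 * p)))
  refine Integrable.mono' hW ?_ ?_
  · have hc : ContinuousOn (fun t : ℝ => Real.exp (β * t) * (K * Mh ν ((q * t) ^ 2))) {0}ᶜ :=
      (by fun_prop : Continuous (fun t : ℝ => Real.exp (β * t))).continuousOn.mul
        (continuousOn_const.mul (Mh_arg_contOn ν hq))
    have := hc.aestronglyMeasurable (μ := volume) (measurableSet_singleton (0:ℝ)).compl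
    rwa [restrict_compl_singleton] at this
  · have : ∀ᵐ t : ℝ, t ≠ 0 := by
      simp [ae_iff]
    filter_upwards [this] with t ht
    have hy : 0 < (q * t) ^ 2 := by positivity
    have ha : 0 < |t| := abs_pos.2 ht
    have h1 := hM _ hy
    rw [norm_mul, norm_mul, Real.norm_of_nonneg (Real.exp_pos _).le,
      Real.norm_of_nonneg (Mh_nonneg _ _), Real.norm_eq_abs]
    have e1 : ((q * t) ^ 2) ^ (-p) = q ^ (-(2 * p)) * |t| ^ (-(2 * p)) := by
      rw [sq_abs_arg, ← Real.rpow_natCast, ← Real.rpow_mul (by positivity),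
        Real.mul_rpow hq.le ha.le]
      push_cast
      rw [show 2 * -p = -(2 * p) by ring]
    have e2 : Real.sqrt ((q * t) ^ 2) = q * |t| := by
      rw [sq_abs_arg, Real.sqrt_sq (by positivity)]
    rw [e1, e2] at h1
    have h2 : Real.exp (β * t) ≤ Real.exp (|β| * |t|) := by
      apply Real.exp_le_exp.2
      rw [← abs_mul]; exact le_abs_self _
    calc Real.exp (β * t) * (|K| * Mh ν ((q * t) ^ 2))
        ≤ Real.exp (|β| * |t|) * (|K| * (C * (q ^ (-(2 * p)) * |t| ^ (-(2 * p)) *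
          Real.exp (-(1 - (1 - |β| / (2 * q)) / 2) * (2 * (q * |t|)))))) := by
          have := Mh_nonneg ν ((q * t) ^ 2)
          gcongr
      _ = |K| * C * q ^ (-(2 * p)) * (|t| ^ (-(2 * p)) * (Real.exp (|β| * |t|) *
          Real.exp (-(1 - (1 - |β| / (2 * q)) / 2) * (2 * (q * |t|))))) := by ring
      _ = _ := by
          rw [← Real.exp_add]
          congr 3
          field_simp
          ring

/-- `x |x|^{2ν} M(-ν, (qx)²) → 0`. -/
lemma kk_small {q ν : ℝ} (hq : 0 < q) (hν : -(1 / 2) < ν) :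
    Tendsto (fun x : ℝ => Mh (-ν) ((q * x) ^ 2) * (x * |x| ^ (2 * ν))) (𝓝[≠] 0) (𝓝 0) := by
  obtain ⟨p, hp, hνp, hp2⟩ : ∃ p : ℝ, 0 < p ∧ 0 < -ν + p ∧ p < ν + 1 / 2 := by
    have h1 := le_max_left ν 0
    have h2 := le_max_right ν 0
    have h3 : max ν 0 < ν + 1 / 2 := max_lt (by linarith) (by linarith)
    exact ⟨(max ν 0 + (ν + 1 / 2)) / 2, by linarith, by linarith, by linarith⟩
  obtain ⟨C, hC, hM⟩ := Mh_bound hp hνp one_pos le_rfl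
  have ht := (tendsto_abs_rpow_zero (ρ := 2 * ν + 1 - 2 * p) (by linarith)).const_mul
    (C * q ^ (-(2 * p)))
  rw [mul_zero] at ht
  apply squeeze_zero_norm' _ ht
  filter_upwards [self_mem_nhdsWithin] with x hx
  have hx : x ≠ 0 := hx
  have hy : 0 < (q * x) ^ 2 := by positivity
  have ha : 0 < |x| := abs_pos.2 hx
  have h1 := hM _ hy
  have e1 : ((q * x) ^ 2) ^ (-p) = q ^ (-(2 * p)) * |x| ^ (-(2 * p)) := by
    rw [sq_abs_arg, ← Real.rpow_natCast, ← Real.rpow_mul (by positivity),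
      Real.mul_rpow hq.le ha.le]
    push_cast
    rw [show 2 * -p = -(2 * p) by ring]
  rw [e1] at h1
  simp only [sub_self, neg_zero, zero_mul, Real.exp_zero, mul_one] at h1
  rw [norm_mul, norm_mul, Real.norm_of_nonneg (Mh_nonneg _ _), Real.norm_eq_abs,
    Real.norm_of_nonneg (by positivity)]
  have e2 : |x| ^ (2 * ν + 1 - 2 * p) = |x| ^ (-(2 * p)) * (|x| * |x| ^ (2 * ν)) := by
    rw [show 2 * ν + 1 - 2 * p = -(2 * p) + (1 + 2 * ν) by ring, Real.rpow_add ha,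
      Real.rpow_add ha, Real.rpow_one]
  rw [e2]
  calc Mh (-ν) ((q * x) ^ 2) * (|x| * |x| ^ (2 * ν))
      ≤ C * (q ^ (-(2 * p)) * |x| ^ (-(2 * p))) * (|x| * |x| ^ (2 * ν)) := by gcongr
    _ = _ := by ring

lemma integral_step {w : ℝ → ℝ} (P x : ℝ) :
    ∫ t in (0:ℝ)..x, w t * ((if t ≤ 0 then (1:ℝ) else 0) - P) =
      ((if x ≤ 0 then (1:ℝ) else 0) - P) * ∫ t in (0:ℝ)..x, w t := by
  rw [← intervalIntegral.integral_const_mul]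
  rcases le_or_gt x 0 with hx | hx
  · apply intervalIntegral.integral_congr
    intro t ht
    rw [uIcc_of_ge hx] at ht
    simp only [ht.2, hx, if_true]
    ring
  · apply intervalIntegral.integral_congr_ae
    refine Eventually.of_forall fun t ht => ?_
    rw [uIoc_of_le hx.le] at ht
    simp only [not_le.2 ht.1, not_le.2 hx, if_false]
    ring

lemma ae_ne_zero : ∀ᵐ t : ℝ, t ≠ 0 := by simp [ae_iff]

lemma stein_form (r θ σ : ℝ) (hr : 0 < r) (hσ : 0 < σ) {q β ν P : ℝ}
    (hqd : q = Real.sqrt (θ ^ 2 + σ ^ 2) / σ ^ 2 / 2) (hq : 0 < q)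
    (hβd : β = θ / σ ^ 2) (hβ : |β| < 2 * q) (hνd : ν = (r - 1) / 2)
    (hP : P = ∫ t, (if t ≤ 0 then (1:ℝ) else 0) * vgDensity r θ σ t) :
    ∃ B0 : ℝ, ∀ x : ℝ, x ≠ 0 →
      steinSolution r θ σ (fun x => if x ≤ 0 then (1:ℝ) else 0) x =
      -(Real.exp (-β * x) / σ ^ 2) *
       ((1 / 2 * q ^ ν * Mh (-ν) ((q * x) ^ 2)) * (((if x ≤ 0 then (1:ℝ) else 0) - P) *
          ∫ t in (0:ℝ)..x, |t| ^ (2 * ν) * (Real.exp (β * t) * (q ^ ν * SI ν ((q * t) ^ 2)))) +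
        (q ^ ν * SI ν ((q * x) ^ 2)) * (B0 - ((if x ≤ 0 then (1:ℝ) else 0) - P) *
          ∫ t in (0:ℝ)..x, Real.exp (β * t) * (1 / 2 * q ^ (-ν) * Mh ν ((q * t) ^ 2)))) := by
  have hν : -(1 / 2) < ν := by rw [hνd]; linarith
  have hwb := wb_integrable hq hβ hν (1 / 2 * q ^ (-ν))
  have harg : ∀ t : ℝ, Real.sqrt (θ ^ 2 + σ ^ 2) / σ ^ 2 * |t| = 2 * (q * |t|) := by
    intro t; rw [hqd]; ring
  have hK : ∀ t : ℝ, t ≠ 0 → besselK ν (2 * (q * |t|)) =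
      1 / 2 * (q ^ (-ν) * |t| ^ (-ν)) * Mh ν ((q * t) ^ 2) := by
    intro t ht
    have ha : 0 < |t| := abs_pos.2 ht
    rw [besselK_eq ν (by positivity), show 2 * (q * |t|) / 2 = q * |t| by ring, ← sq_abs_arg,
      Real.mul_rpow hq.le ha.le]
  have hK' : ∀ t : ℝ, t ≠ 0 → besselK ν (2 * (q * |t|)) =
      1 / 2 * (q ^ ν * |t| ^ ν) * Mh (-ν) ((q * t) ^ 2) := by
    intro t ht
    have ha : 0 < |t| := abs_pos.2 ht
    rw [← besselK_neg, besselK_eq (-ν) (by positivity), show 2 * (q * |t|) / 2 = q * |t| by ring,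
      ← sq_abs_arg, neg_neg, Real.mul_rpow hq.le ha.le]
  have hI : ∀ t : ℝ, t ≠ 0 → besselI ν (2 * (q * |t|)) =
      (q ^ ν * |t| ^ ν) * SI ν ((q * t) ^ 2) := by
    intro t ht
    have ha : 0 < |t| := abs_pos.2 ht
    rw [besselI_eq ν (by positivity), show 2 * (q * |t|) / 2 = q * |t| by ring, ← sq_abs_arg,
      Real.mul_rpow hq.le ha.le]
  have hB : Integrable (fun t : ℝ => Real.exp (β * t) * (1 / 2 * q ^ (-ν) * Mh ν ((q * t) ^ 2)) *
      ((if t ≤ 0 then (1:ℝ) else 0) - P)) := by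
    refine hwb.mul_bdd (c := 1 + |P|) ?_ ?_
    · apply Measurable.aestronglyMeasurable
      exact (Measurable.ite measurableSet_Iic measurable_const measurable_const).sub_const P
    · refine Eventually.of_forall fun t => ?_
      refine (norm_sub_le _ _).trans ?_
      simp only [Real.norm_eq_abs]
      gcongr
      split_ifs <;> simp
  refine ⟨∫ t in Set.Ioi (0:ℝ), Real.exp (β * t) * (1 / 2 * q ^ (-ν) * Mh ν ((q * t) ^ 2)) *
      ((if t ≤ 0 then (1:ℝ) else 0) - P), ?_⟩
  intro x hx
  have ha : 0 < |x| := abs_pos.2 hx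
  unfold steinSolution htilde
  rw [← hP, ← hνd, ← hβd]
  simp only [harg]
  have eA : ∫ t in (0:ℝ)..x, Real.exp (β * t) * |t| ^ ν * besselI ν (2 * (q * |t|)) *
      ((if t ≤ 0 then (1:ℝ) else 0) - P) = ((if x ≤ 0 then (1:ℝ) else 0) - P) *
          ∫ t in (0:ℝ)..x, |t| ^ (2 * ν) * (Real.exp (β * t) * (q ^ ν * SI ν ((q * t) ^ 2))) := by
    rw [← integral_step]
    apply intervalIntegral.integral_congr_ae
    filter_upwards [ae_ne_zero] with t ht _
    have ha : 0 < |t| := abs_pos.2 ht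
    rw [hI t ht, show 2 * ν = ν + ν by ring, Real.rpow_add ha]
    ring
  have eB : ∫ t in Set.Ioi x, Real.exp (β * t) * |t| ^ ν * besselK ν (2 * (q * |t|)) *
      ((if t ≤ 0 then (1:ℝ) else 0) - P) =
      (∫ t in Set.Ioi (0:ℝ), Real.exp (β * t) * (1 / 2 * q ^ (-ν) * Mh ν ((q * t) ^ 2)) *
      ((if t ≤ 0 then (1:ℝ) else 0) - P)) - ((if x ≤ 0 then (1:ℝ) else 0) - P) *
          ∫ t in (0:ℝ)..x, Real.exp (β * t) * (1 / 2 * q ^ (-ν) * Mh ν ((q * t) ^ 2)) := by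
    rw [← integral_step, ← intervalIntegral.integral_Ioi_sub_Ioi' hB.integrableOn hB.integrableOn,
      sub_sub_cancel]
    apply integral_congr_ae
    filter_upwards [ae_restrict_of_ae ae_ne_zero] with t ht
    have ha : 0 < |t| := abs_pos.2 ht
    have hpos := Real.rpow_pos_of_pos ha ν
    rw [hK t ht, Real.rpow_neg ha.le]
    field_simp
  rw [eA, eB, hK' x hx, hI x hx]
  have hpos := Real.rpow_pos_of_pos ha ν
  generalize (∫ t in Set.Ioi (0:ℝ), Real.exp (β * t) * (1 / 2 * q ^ (-ν) * Mh ν ((q * t) ^ 2)) *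
      ((if t ≤ 0 then (1:ℝ) else 0) - P)) = X1
  generalize (∫ t in (0:ℝ)..x, Real.exp (β * t) * (1 / 2 * q ^ (-ν) * Mh ν ((q * t) ^ 2))) = X2
  generalize (∫ t in (0:ℝ)..x, |t| ^ (2 * ν) *
    (Real.exp (β * t) * (q ^ ν * SI ν ((q * t) ^ 2)))) = X3
  field_simp
  ring

lemma step_eventually {x : ℝ} (hx : x ≠ 0) :
    ∀ᶠ z in 𝓝 x, (if z ≤ 0 then (1:ℝ) else 0) = (if x ≤ 0 then (1:ℝ) else 0) := by
  rcases lt_or_gt_of_ne hx with h | h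
  · filter_upwards [Iio_mem_nhds h] with z hz
    have hz : z < 0 := hz
    simp [hz.le, h.le]
  · filter_upwards [Ioi_mem_nhds h] with z hz
    have hz : 0 < z := hz
    simp [not_le.2 hz, not_le.2 h]

theorem stein_solution_indicator_derivative_discontinuous (r θ σ : ℝ) (hr : 0 < r) (hσ : 0 < σ) :
    ∃ (g : ℝ → ℝ) (Lp Lm : ℝ),
      (∀ x : ℝ, x ≠ 0 →
        HasDerivAt (steinSolution r θ σ (fun x => if x ≤ 0 then (1:ℝ) else 0)) (g x) x) ∧
      Filter.Tendsto g (nhdsWithin 0 (Set.Ioi 0)) (nhds Lp) ∧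
      Filter.Tendsto g (nhdsWithin 0 (Set.Iio 0)) (nhds Lm) ∧
      Lp - Lm = -1 / (r * σ ^ 2) := by
  obtain ⟨q, hqd⟩ : ∃ q, q = Real.sqrt (θ ^ 2 + σ ^ 2) / σ ^ 2 / 2 := ⟨_, rfl⟩
  obtain ⟨β, hβd⟩ : ∃ β, β = θ / σ ^ 2 := ⟨_, rfl⟩
  obtain ⟨ν, hνd⟩ : ∃ ν, ν = (r - 1) / 2 := ⟨_, rfl⟩
  obtain ⟨P, hP⟩ : ∃ P, P = ∫ t, (if t ≤ 0 then (1:ℝ) else 0) * vgDensity r θ σ t := ⟨_, rfl⟩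
  have hq : 0 < q := by rw [hqd]; positivity
  have hβ : |β| < 2 * q := by
    rw [hβd, hqd, abs_div, abs_of_pos (by positivity : 0 < σ ^ 2)]
    rw [show 2 * (Real.sqrt (θ ^ 2 + σ ^ 2) / σ ^ 2 / 2) = Real.sqrt (θ ^ 2 + σ ^ 2) / σ ^ 2 by ring]
    have : |θ| < Real.sqrt (θ ^ 2 + σ ^ 2) := by
      apply Real.lt_sqrt_of_sq_lt
      rw [sq_abs]
      have : 0 < σ ^ 2 := by positivity
      linarith
    gcongr
  have hν : -(1 / 2) < ν := by rw [hνd]; linarith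
  have hν1 : -1 < ν := by linarith
  have hρ : -1 < 2 * ν := by linarith
  have hr' : 2 * ν + 1 = r := by rw [hνd]; ring
  obtain ⟨B0, hform⟩ := stein_form r θ σ hr hσ hqd hq hβd hβ hνd hP
  -- the ingredients
  obtain ⟨φ, hφd⟩ : ∃ φ : ℝ → ℝ, φ = fun t => Real.exp (β * t) * (q ^ ν * SI ν ((q * t) ^ 2)) :=
    ⟨_, rfl⟩
  obtain ⟨wb, hwbd⟩ : ∃ w : ℝ → ℝ,
    w = fun t => Real.exp (β * t) * (1 / 2 * q ^ (-ν) * Mh ν ((q * t) ^ 2)) := ⟨_, rfl⟩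
  obtain ⟨A, hA⟩ : ∃ A : ℝ → ℝ, A = fun x => ∫ t in (0:ℝ)..x, |t| ^ (2 * ν) * φ t := ⟨_, rfl⟩
  obtain ⟨J, hJ⟩ : ∃ J : ℝ → ℝ, J = fun x => ∫ t in (0:ℝ)..x, wb t := ⟨_, rfl⟩
  obtain ⟨kk, hkk⟩ : ∃ k : ℝ → ℝ, k = fun x => 1 / 2 * q ^ ν * Mh (-ν) ((q * x) ^ 2) := ⟨_, rfl⟩
  obtain ⟨ii, hii⟩ : ∃ k : ℝ → ℝ, k = fun x => q ^ ν * SI ν ((q * x) ^ 2) := ⟨_, rfl⟩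
  obtain ⟨kk', hkk'⟩ : ∃ k : ℝ → ℝ,
    k = fun x => 1 / 2 * q ^ ν * (-Mh (-ν - 1) ((q * x) ^ 2) * (2 * q ^ 2 * x)) := ⟨_, rfl⟩
  obtain ⟨ii', hii'⟩ : ∃ k : ℝ → ℝ,
    k = fun x => q ^ ν * (deriv (SI ν) ((q * x) ^ 2) * (2 * q ^ 2 * x)) := ⟨_, rfl⟩
  have hSc : Continuous (SI ν) :=
    continuous_iff_continuousAt.2 fun y => (SI_analytic hν1 y).continuousAt
  have hS'c : Continuous (deriv (SI ν)) :=
    continuous_iff_continuousAt.2 fun y => (SI_analytic hν1 y).deriv.continuousAt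
  have hφc : Continuous φ := by rw [hφd]; fun_prop
  have hiic : Continuous ii := by rw [hii]; fun_prop
  have hii'c : Continuous ii' := by rw [hii']; fun_prop
  have hwbi : ∀ a b, IntervalIntegrable wb volume a b := fun a b => by
    rw [hwbd]; exact (wb_integrable hq hβ hν _).intervalIntegrable
  have hwbc : ContinuousOn wb {0}ᶜ := by
    rw [hwbd]
    exact (by fun_prop : Continuous (fun t : ℝ => Real.exp (β * t))).continuousOn.mul
        (continuousOn_const.mul (Mh_arg_contOn ν hq))
  have hAd : ∀ x : ℝ, x ≠ 0 → HasDerivAt A (|x| ^ (2 * ν) * φ x) x := fun x hx => by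
    rw [hA]
    exact ftc_off_zero ((contOn_abs_rpow _).mul hφc.continuousOn) (intervalIntegrable_abs_mul hρ hφc) hx
  have hJd : ∀ x : ℝ, x ≠ 0 → HasDerivAt J (wb x) x := fun x hx => by
    rw [hJ]
    exact ftc_off_zero hwbc hwbi hx
  have hkkd : ∀ x : ℝ, x ≠ 0 → HasDerivAt kk (kk' x) x := fun x hx => by
    rw [hkk, hkk']
    exact (Mh_arg_hasDerivAt (-ν) hq hx).const_mul _
  have hiid : ∀ x : ℝ, HasDerivAt ii (ii' x) x := fun x => by
    rw [hii, hii']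
    have h1 : HasDerivAt (fun x : ℝ => (q * x) ^ 2) (2 * q ^ 2 * x) x := by
      refine (((hasDerivAt_id x).const_mul q).pow 2).congr_deriv ?_
      simp only [id]; push_cast; ring
    have h2 := (SI_analytic hν1 ((q * x) ^ 2)).differentiableAt.hasDerivAt
    exact (h2.comp x h1).const_mul _
  have hpowq : 0 < q ^ ν := Real.rpow_pos_of_pos hq ν
  have hcancel : ∀ x : ℝ, x ≠ 0 → kk x * (|x| ^ (2 * ν) * φ x) = ii x * wb x := by
    intro x hx
    have ha : 0 < |x| := abs_pos.2 hx
    have hpa := Real.rpow_pos_of_pos ha (2 * ν)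
    rw [hkk, hφd, hii, hwbd]
    simp only
    have h1 := Mh_neg ν (w := q * |x|) (by positivity)
    rw [← sq_abs_arg, Real.mul_rpow hq.le ha.le, Real.rpow_neg ha.le] at h1
    have h2 : q ^ (-(2 * ν)) * q ^ ν = q ^ (-ν) := by
      rw [← Real.rpow_add hq]; congr 1; ring
    rw [h1, ← h2]
    field_simp
  -- limits
  have hAlim : Tendsto (fun x => A x / (x * |x| ^ (2 * ν))) (𝓝[≠] 0) (𝓝 (φ 0 / r)) := by
    rw [hA, ← hr']
    exact weight_asymp hρ hφc
  have hφ0 : φ 0 = q ^ ν * (1 / Real.Gamma (ν + 1)) := by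
    rw [hφd]; simp [SI_zero]
  have hne : ∀ x : ℝ, x ≠ 0 → x * |x| ^ (2 * ν) ≠ 0 := fun x hx =>
    mul_ne_zero hx (Real.rpow_pos_of_pos (abs_pos.2 hx) _).ne'
  have hkA : Tendsto (fun x => kk x * A x) (𝓝[≠] 0) (𝓝 0) := by
    have h := (((kk_small hq hν).const_mul (1 / 2 * q ^ ν)).mul hAlim)
    simp only [mul_zero, zero_mul] at h
    refine h.congr' ?_
    filter_upwards [self_mem_nhdsWithin] with x hx
    have := hne x hx
    rw [hkk]
    simp only
    rw [mul_assoc, mul_assoc, mul_assoc, mul_div_cancel₀ _ this, ← mul_assoc, ← mul_assoc]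
  have hk'A : Tendsto (fun x => kk' x * A x) (𝓝[≠] 0) (𝓝 (-(1 / r))) := by
    have hG : 0 < Real.Gamma (ν + 1) := Real.Gamma_pos_of_pos (by linarith)
    have h := (((Mh_tendsto (a := ν + 1) (by linarith)).comp (tendsto_arg hq)).const_mul
      (-(q ^ ν)⁻¹)).mul hAlim
    have e : -(q ^ ν)⁻¹ * Real.Gamma (ν + 1) * (φ 0 / r) = -(1 / r) := by
      rw [hφ0]; field_simp
    rw [e] at h
    refine h.congr' ?_
    filter_upwards [self_mem_nhdsWithin] with x hx
    have hx : x ≠ 0 := hx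
    have ha : 0 < |x| := abs_pos.2 hx
    have hpa := Real.rpow_pos_of_pos ha (2 * ν)
    rw [hkk']
    simp only [Function.comp]
    have h1 := Mh_neg (ν + 1) (w := q * |x|) (by positivity)
    rw [← sq_abs_arg, Real.mul_rpow hq.le ha.le, show -(ν + 1) = -ν - 1 by ring] at h1
    have h2 : |x| ^ (-(2 * (ν + 1))) = (|x| ^ (2 * ν))⁻¹ * (x ^ 2)⁻¹ := by
      rw [← Real.rpow_neg ha.le, ← sq_abs, ← Real.rpow_natCast, ← Real.rpow_neg ha.le,
        ← Real.rpow_add ha]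
      congr 1; push_cast; ring
    have h3 : q ^ (-(2 * (ν + 1))) = (q ^ ν)⁻¹ * (q ^ ν)⁻¹ * (q ^ 2)⁻¹ := by
      rw [← Real.rpow_neg hq.le, ← Real.rpow_natCast, ← Real.rpow_neg hq.le,
        ← Real.rpow_add hq, ← Real.rpow_add hq]
      congr 1; push_cast; ring
    rw [h1, h2, h3]
    field_simp
  have hJ0 : Tendsto J (𝓝[≠] 0) (𝓝 0) := by
    rw [hJ]; exact primitive_tendsto_zero hwbi
  have hii0 : Tendsto ii (𝓝[≠] 0) (𝓝 (ii 0)) := (hiic.tendsto 0).mono_left nhdsWithin_le_nhds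
  have hii'0 : Tendsto ii' (𝓝[≠] 0) (𝓝 0) := by
    have : ii' 0 = 0 := by rw [hii']; simp
    have h := (hii'c.tendsto 0).mono_left (nhdsWithin_le_nhds (s := {0}ᶜ))
    rwa [this] at h
  have hE : Tendsto (fun x : ℝ => Real.exp (-β * x) / σ ^ 2) (𝓝[≠] 0) (𝓝 (1 / σ ^ 2)) := by
    have hc : Continuous (fun x : ℝ => Real.exp (-β * x) / σ ^ 2) := by fun_prop
    have h := (hc.tendsto 0).mono_left (nhdsWithin_le_nhds (s := {0}ᶜ))
    simpa using h
  obtain ⟨U, hU⟩ : ∃ U : ℝ → ℝ, U = fun x => Real.exp (-β * x) / σ ^ 2 *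
    (β * (kk x * A x) - β * (ii x * J x) - kk' x * A x + ii' x * J x) := ⟨_, rfl⟩
  obtain ⟨V, hV⟩ : ∃ V : ℝ → ℝ, V = fun x => Real.exp (-β * x) / σ ^ 2 *
    (β * (ii x * B0) - ii' x * B0) := ⟨_, rfl⟩
  have hUlim : Tendsto U (𝓝[≠] 0) (𝓝 (1 / σ ^ 2 * (1 / r))) := by
    have h := hE.mul ((((hkA.const_mul β).sub ((hii0.mul hJ0).const_mul β)).sub hk'A).add
      (hii'0.mul hJ0))
    rw [hU]
    convert h using 2
    ring
  have hVlim : Tendsto V (𝓝[≠] 0) (𝓝 (1 / σ ^ 2 * (β * (ii 0 * B0) - 0 * B0))) := by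
    rw [hV]
    exact hE.mul (((hii0.mul_const B0).const_mul β).sub (hii'0.mul_const B0))
  have hgt : 𝓝[>] (0:ℝ) ≤ 𝓝[≠] 0 := nhdsWithin_mono _ (fun x hx => ne_of_gt hx)
  have hlt : 𝓝[<] (0:ℝ) ≤ 𝓝[≠] 0 := nhdsWithin_mono _ (fun x hx => ne_of_lt hx)
  refine ⟨fun x => ((if x ≤ 0 then (1:ℝ) else 0) - P) * U x + V x,
    (0 - P) * (1 / σ ^ 2 * (1 / r)) + 1 / σ ^ 2 * (β * (ii 0 * B0) - 0 * B0),
    (1 - P) * (1 / σ ^ 2 * (1 / r)) + 1 / σ ^ 2 * (β * (ii 0 * B0) - 0 * B0), ?_, ?_, ?_, ?_⟩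
  · intro x hx
    have hev : steinSolution r θ σ (fun x => if x ≤ 0 then (1:ℝ) else 0) =ᶠ[𝓝 x]
        fun z => -(Real.exp (-β * z) / σ ^ 2) *
          (kk z * (((if x ≤ 0 then (1:ℝ) else 0) - P) * A z) +
           ii z * (B0 - ((if x ≤ 0 then (1:ℝ) else 0) - P) * J z)) := by
      filter_upwards [step_eventually hx, isOpen_compl_singleton.mem_nhds hx] with z hz hz0
      rw [hform z hz0, hz, hkk, hii, hA, hJ, hφd, hwbd]
    refine HasDerivAt.congr_of_eventuallyEq ?_ hev
    beta_reduce
    generalize ((if x ≤ 0 then (1:ℝ) else 0) - P) = H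
    have hexp : HasDerivAt (fun z : ℝ => -(Real.exp (-β * z) / σ ^ 2))
        (-(Real.exp (-β * x) * (-β) / σ ^ 2)) x := by
      have h1 : HasDerivAt (fun z : ℝ => -β * z) (-β) x := by
        simpa using (hasDerivAt_id x).const_mul (-β)
      exact (h1.exp.div_const _).neg
    have hd := hexp.mul (((hkkd x hx).mul ((hAd x hx).const_mul H)).add
      ((hiid x).mul (((hJd x hx).const_mul H).const_sub B0)))
    refine hd.congr_deriv ?_
    have hc := hcancel x hx
    rw [hU, hV]
    simp only [Pi.add_apply, Pi.mul_apply]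
    linear_combination (-(Real.exp (-β * x) / σ ^ 2) * H) * hc
  · refine (((hUlim.mono_left hgt).const_mul (0 - P)).add (hVlim.mono_left hgt)).congr' ?_
    filter_upwards [self_mem_nhdsWithin] with x hx
    have hx : 0 < x := hx
    simp [not_le.2 hx]
  · refine (((hUlim.mono_left hlt).const_mul (1 - P)).add (hVlim.mono_left hlt)).congr' ?_
    filter_upwards [self_mem_nhdsWithin] with x hx
    have hx : x < 0 := hx
    simp [hx.le]
  · field_simp
    ring
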